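/- arXiv:2308.11566 — 2 statements merged into one kernel-verified Lean document; each statement's English description precedes it below -/
import Mathlib

section
/- For every positive integer n and every positive integer d, the set of positive definite integral quadratic forms in n variables with discriminant d has only finitely many equivalence classes under the action of GL_n(ℤ). -/
open scoped BigOperators

/-- The integral quadratic form `Q(x) = ∑_{i ≤ j} a_{ij} x_i x_j` attached to the
coefficient matrix `a` (only entries with `i ≤ j` are used). -/
def Qform {n : ℕ} (a : Matrix (Fin n) (Fin n) ℤ) (x : Fin n → ℤ) : ℤ :=
  ∑ i, ∑ j, if i ≤ j then a i j * x i * x j else 0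

/-- The associated bilinear form `T(x,y) = Q(x+y) - Q(x) - Q(y)`. -/
def Tbil {n : ℕ} (a : Matrix (Fin n) (Fin n) ℤ) (x y : Fin n → ℤ) : ℤ :=
  Qform a (x + y) - Qform a x - Qform a y

/-- The Gram matrix `[T] = (T(e_i, e_j))_{i,j}`. -/
def gram {n : ℕ} (a : Matrix (Fin n) (Fin n) ℤ) : Matrix (Fin n) (Fin n) ℤ :=
  Matrix.of fun i j => Tbil a (Pi.single i 1) (Pi.single j 1)

/-- `ε(n) = 0` if `n` is even, `1` if `n` is odd. -/
def eps (n : ℕ) : ℕ := if Even n then 0 else 1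

/-- `Q` has (half-)discriminant `d`, i.e. `det [T] = 2^{ε(n)} d`. -/
def HasDisc {n : ℕ} (a : Matrix (Fin n) (Fin n) ℤ) (d : ℤ) : Prop :=
  (gram a).det = 2 ^ (eps n) * d

/-- `Q` is positive definite: `Q(x) > 0` for all `x ≠ 0`. -/
def PosDef {n : ℕ} (a : Matrix (Fin n) (Fin n) ℤ) : Prop :=
  ∀ x : Fin n → ℤ, x ≠ 0 → 0 < Qform a x

/-- Two integral quadratic forms (as functions) are `GL_n(ℤ)`-equivalent:
`Q'(x) = Q(g⁻¹ x)` for some `g ∈ GL_n(ℤ)`. -/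
def FormEquiv {n : ℕ} (Q Q' : (Fin n → ℤ) → ℤ) : Prop :=
  ∃ g : GL (Fin n) ℤ, ∀ x, Q' x = Q (Matrix.mulVec (↑(g⁻¹) : Matrix (Fin n) (Fin n) ℤ) x)

namespace Herm

open Matrix

/-- Integral equivalence of Gram matrices. -/
def Eqv {n : ℕ} (A B : Matrix (Fin n) (Fin n) ℤ) : Prop :=
  ∃ U : Matrix (Fin n) (Fin n) ℤ, IsUnit U.det ∧ B = Uᵀ * A * U

/-- Positive on nonzero integer vectors. -/
def PD {n : ℕ} (A : Matrix (Fin n) (Fin n) ℤ) : Prop :=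
  ∀ x : Fin n → ℤ, x ≠ 0 → 0 < x ⬝ᵥ (A *ᵥ x)

/-- Scaled Schur complement of the top left entry. -/
def schur {n : ℕ} (A : Matrix (Fin (n+1)) (Fin (n+1)) ℤ) : Matrix (Fin n) (Fin n) ℤ :=
  Matrix.of fun i j => A 0 0 * A i.succ j.succ - A 0 i.succ * A 0 j.succ

theorem Eqv.refl {n : ℕ} (A : Matrix (Fin n) (Fin n) ℤ) : Eqv A A :=
  ⟨1, by simp, by simp⟩

theorem Eqv.trans {n : ℕ} {A B C : Matrix (Fin n) (Fin n) ℤ} (h : Eqv A B) (h' : Eqv B C) :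
    Eqv A C := by
  obtain ⟨U, hU, rfl⟩ := h
  obtain ⟨V, hV, rfl⟩ := h'
  refine ⟨U * V, ?_, ?_⟩
  · rw [det_mul]; exact hU.mul hV
  · simp only [transpose_mul, Matrix.mul_assoc]

theorem Eqv.symm_of {n : ℕ} {A B : Matrix (Fin n) (Fin n) ℤ} (h : Eqv A B) (hA : A.IsSymm) :
    B.IsSymm := by
  obtain ⟨U, hU, rfl⟩ := h
  unfold Matrix.IsSymm at *
  simp only [transpose_mul, transpose_transpose, hA, Matrix.mul_assoc]

theorem Eqv.det_eq {n : ℕ} {A B : Matrix (Fin n) (Fin n) ℤ} (h : Eqv A B) : B.det = A.det := by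
  obtain ⟨U, hU, rfl⟩ := h
  rw [det_mul, det_mul, det_transpose]
  rcases Int.isUnit_iff.1 hU with h | h <;> rw [h] <;> ring

theorem quad_conj {n : ℕ} (A U : Matrix (Fin n) (Fin n) ℤ) (x : Fin n → ℤ) :
    x ⬝ᵥ ((Uᵀ * A * U) *ᵥ x) = (U *ᵥ x) ⬝ᵥ (A *ᵥ (U *ᵥ x)) := by
  rw [← Matrix.mulVec_mulVec, ← Matrix.mulVec_mulVec, Matrix.dotProduct_mulVec,
    Matrix.vecMul_transpose]

theorem Eqv.pd {n : ℕ} {A B : Matrix (Fin n) (Fin n) ℤ} (h : Eqv A B) (hA : PD A) : PD B := by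
  obtain ⟨U, hU, rfl⟩ := h
  intro x hx
  rw [quad_conj]
  apply hA
  intro h0
  apply hx
  have : (U⁻¹ * U) *ᵥ x = 0 := by rw [← Matrix.mulVec_mulVec, h0, Matrix.mulVec_zero]
  rwa [Matrix.nonsing_inv_mul _ hU, Matrix.one_mulVec] at this

theorem PD.diag_pos {n : ℕ} {A : Matrix (Fin n) (Fin n) ℤ} (h : PD A) (i : Fin n) : 0 < A i i := by
  have := h (Pi.single i 1) (by simp)
  simpa using this

theorem schur_det {n : ℕ} (A : Matrix (Fin (n+1)) (Fin (n+1)) ℤ) (hA : A.IsSymm) :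
    (schur A).det * A 0 0 = A 0 0 ^ n * A.det := by
  let E : Matrix (Fin (n+1)) (Fin (n+1)) ℤ :=
    Matrix.of fun i j => Fin.cases (Fin.cases 1 (fun _ => 0) j)
      (fun i' => Fin.cases (- A 0 i'.succ) (fun j' => if i' = j' then A 0 0 else 0) j) i
  have hE : E.det = A 0 0 ^ n := by
    rw [det_succ_row_zero, Fin.sum_univ_succ]
    have : E.submatrix Fin.succ (Fin.succAbove 0) = A 0 0 • (1 : Matrix (Fin n) (Fin n) ℤ) := by
      ext i j
      simp [E, Matrix.one_apply]
    rw [this, det_smul]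
    simp [E]
  have h0 : ∀ i : Fin n, A i.succ 0 = A 0 i.succ := fun i => hA.apply _ _
  have hEA : (E * A).det = A 0 0 * (schur A).det := by
    have h1 : ∀ i : Fin n, (E * A) i.succ 0 = 0 := by
      intro i
      simp [Matrix.mul_apply, Fin.sum_univ_succ, E, h0]
      ring
    have h2 : (E * A) 0 0 = A 0 0 := by
      simp [Matrix.mul_apply, Fin.sum_univ_succ, E]
    have h3 : (E * A).submatrix (Fin.succAbove 0) Fin.succ = schur A := by
      ext i j
      simp [Matrix.mul_apply, Fin.sum_univ_succ, E, schur]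
      ring
    rw [det_succ_column_zero, Fin.sum_univ_succ]
    simp only [h1, h2, h3]
    simp
  rw [mul_comm, ← hEA, det_mul, hE]

theorem schur_symm {n : ℕ} (A : Matrix (Fin (n+1)) (Fin (n+1)) ℤ) (hA : A.IsSymm) :
    (schur A).IsSymm := by
  ext i j
  simp only [schur, transpose_apply, of_apply]
  rw [hA.apply i.succ j.succ]
  ring

theorem schur_pd {n : ℕ} (A : Matrix (Fin (n+1)) (Fin (n+1)) ℤ) (hA : A.IsSymm) (hp : PD A) :
    PD (schur A) := by
  intro y hy
  have hm := hp.diag_pos 0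
  have h0 : ∀ i : Fin n, A i.succ 0 = A 0 i.succ := fun i => hA.apply _ _
  set w := ∑ i : Fin n, A 0 i.succ * y i with hw
  set q := ∑ i : Fin n, y i * ∑ j : Fin n, A i.succ j.succ * y j with hq
  have key := hp (Fin.cons (- w) (fun i => A 0 0 * y i)) (by
    intro h
    apply hy
    ext i
    have := congrFun h i.succ
    simp at this
    rcases this with h | h
    · omega
    · exact h)
  have e1 : (Fin.cons (- w) (fun i => A 0 0 * y i) : Fin (n+1) → ℤ) ⬝ᵥ
      (A *ᵥ (Fin.cons (- w) (fun i => A 0 0 * y i))) = A 0 0 * (A 0 0 * q - w * w) := by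
    have a1 : ∑ j : Fin n, A 0 j.succ * (A 0 0 * y j) = A 0 0 * w := by
      rw [hw, Finset.mul_sum]; exact Finset.sum_congr rfl fun _ _ => by ring
    have a2 : ∀ i : Fin n, ∑ j : Fin n, A i.succ j.succ * (A 0 0 * y j)
        = A 0 0 * ∑ j : Fin n, A i.succ j.succ * y j := by
      intro i
      rw [Finset.mul_sum]; exact Finset.sum_congr rfl fun _ _ => by ring
    simp only [dotProduct, mulVec, Fin.sum_univ_succ, Fin.cons_zero, Fin.cons_succ, a1, a2, h0]
    have a3 : ∑ i : Fin n, A 0 0 * y i * (A 0 i.succ * -w + A 0 0 * ∑ j : Fin n, A i.succ j.succ * y j)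
       = - w * A 0 0 * w + A 0 0 * A 0 0 * q := by
      conv_rhs => rw [hq, Finset.mul_sum]
      conv_rhs => enter [1, 2]; rw [hw]
      rw [Finset.mul_sum, ← Finset.sum_add_distrib]
      exact Finset.sum_congr rfl fun _ _ => by ring
    rw [a3]; ring
  have e2 : y ⬝ᵥ (schur A *ᵥ y) = A 0 0 * q - w * w := by
    simp only [dotProduct, mulVec, schur, of_apply]
    have b : ∀ i : Fin n, ∑ j : Fin n, (A 0 0 * A i.succ j.succ - A 0 i.succ * A 0 j.succ) * y j
        = A 0 0 * (∑ j : Fin n, A i.succ j.succ * y j) - A 0 i.succ * w := by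
      intro i
      rw [hw, Finset.mul_sum, Finset.mul_sum, ← Finset.sum_sub_distrib]
      exact Finset.sum_congr rfl fun _ _ => by ring
    simp only [b]
    conv_rhs => rw [hq, Finset.mul_sum]
    conv_rhs => enter [2, 1]; rw [hw]
    rw [Finset.sum_mul, ← Finset.sum_sub_distrib]
    exact Finset.sum_congr rfl fun _ _ => by ring
  rw [e1] at key
  rw [e2]
  exact pos_of_mul_pos_right key hm.le

theorem shift {n : ℕ} (A : Matrix (Fin (n+1)) (Fin (n+1)) ℤ) (hA : A.IsSymm) (hm : 0 < A 0 0)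
    (B : Matrix (Fin n) (Fin n) ℤ) (hB : Eqv (schur A) B) :
    ∃ A', Eqv A A' ∧ A' 0 0 = A 0 0 ∧ schur A' = B ∧ ∀ i : Fin n, |2 * A' 0 i.succ| ≤ A 0 0 := by
  obtain ⟨V, hV, rfl⟩ := hB
  have h0 : ∀ i : Fin n, A i.succ 0 = A 0 i.succ := fun i => hA.apply _ _
  let w : Fin n → ℤ := fun j => ∑ k : Fin n, A 0 k.succ * V k j
  let t : Fin n → ℤ := fun j => - ((2 * w j + A 0 0) / (2 * A 0 0))
  let U : Matrix (Fin (n+1)) (Fin (n+1)) ℤ :=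
    Matrix.of fun i j => Fin.cases (Fin.cases 1 t j)
      (fun i' => Fin.cases 0 (fun j' => V i' j') j) i
  have U00 : U 0 0 = 1 := rfl
  have U0s : ∀ j : Fin n, U 0 j.succ = t j := fun _ => rfl
  have Us0 : ∀ j : Fin n, U j.succ 0 = 0 := fun _ => rfl
  have Uss : ∀ i j : Fin n, U i.succ j.succ = V i j := fun _ _ => rfl
  have hU : U.det = V.det := by
    rw [det_succ_column_zero, Fin.sum_univ_succ]
    have : U.submatrix (Fin.succAbove 0) Fin.succ = V := by
      ext i j
      simp [Uss]
    simp only [Us0, this, U00]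
    simp
  have A00 : (Uᵀ * A * U) 0 0 = A 0 0 := by
    simp [Matrix.mul_apply, Fin.sum_univ_succ, U00, Us0]
  have A0s : ∀ j : Fin n, (Uᵀ * A * U) 0 j.succ = A 0 0 * t j + w j := by
    intro j
    simp [Matrix.mul_apply, Fin.sum_univ_succ, U00, Us0, U0s, Uss, w]
  have Ass : ∀ i j : Fin n, (Uᵀ * A * U) i.succ j.succ =
      A 0 0 * t i * t j + t i * w j + w i * t j +
        ∑ k : Fin n, (∑ l : Fin n, V l i * A l.succ k.succ) * V k j := by
    intro i j
    have c1 : ∑ k : Fin n, V k i * A 0 k.succ = w i :=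
      Finset.sum_congr rfl fun _ _ => by ring
    simp only [Matrix.mul_apply, Fin.sum_univ_succ, U00, Us0, U0s, Uss, transpose_apply, h0, c1]
    simp only [add_mul, Finset.sum_add_distrib]
    have c2 : ∑ k : Fin n, t i * A 0 k.succ * V k j = t i * w j := by
      simp only [w, Finset.mul_sum, mul_assoc]
    rw [c2]; ring
  refine ⟨Uᵀ * A * U, ⟨U, hU ▸ hV, rfl⟩, A00, ?_, ?_⟩
  · ext i j
    simp only [schur, of_apply, A00, A0s, Ass]
    have d : (Vᵀ * (of fun i j : Fin n => A 0 0 * A i.succ j.succ - A 0 i.succ * A 0 j.succ) * V) i j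
        = A 0 0 * (∑ k : Fin n, (∑ l : Fin n, V l i * A l.succ k.succ) * V k j) - w i * w j := by
      simp only [Matrix.mul_apply, transpose_apply, of_apply]
      have d1 : ∀ k : Fin n, ∑ l : Fin n, V l i * (A 0 0 * A l.succ k.succ - A 0 l.succ * A 0 k.succ)
          = A 0 0 * (∑ l : Fin n, V l i * A l.succ k.succ) - w i * A 0 k.succ := by
        intro k
        simp only [w]
        rw [Finset.mul_sum, Finset.sum_mul, ← Finset.sum_sub_distrib]
        exact Finset.sum_congr rfl fun _ _ => by ring
      simp only [d1]
      have d2 : w i * w j = ∑ k : Fin n, w i * (A 0 k.succ * V k j) := by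
        rw [← Finset.mul_sum]
      rw [d2, Finset.mul_sum, ← Finset.sum_sub_distrib]
      exact Finset.sum_congr rfl fun _ _ => by ring
    rw [d]; ring
  · intro i
    rw [A0s]
    simp only [t]
    have e1 := Int.emod_add_mul_ediv (2 * w i + A 0 0) (2 * A 0 0)
    have e2 := Int.emod_nonneg (2 * w i + A 0 0) (b := 2 * A 0 0) (by omega)
    have e3 := Int.emod_lt_of_pos (2 * w i + A 0 0) (b := 2 * A 0 0) (by omega)
    rw [abs_le]
    constructor <;> linarith

theorem swap_eqv {n : ℕ} (A : Matrix (Fin (n+2)) (Fin (n+2)) ℤ) :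
    ∃ A', Eqv A A' ∧ A' 0 0 = A 1 1 := by
  let σ : Equiv.Perm (Fin (n+2)) := Equiv.swap 0 1
  refine ⟨_, ⟨(1 : Matrix _ _ ℤ).submatrix id σ, ?_, rfl⟩, ?_⟩
  · rw [det_permute']
    simp [σ]
  · simp [Matrix.mul_apply, Matrix.one_apply, σ]

theorem exists_min {n : ℕ} (A : Matrix (Fin (n+1)) (Fin (n+1)) ℤ) (hp : PD A) :
    ∃ A', Eqv A A' ∧ ∀ A'', Eqv A A'' → A' 0 0 ≤ A'' 0 0 := by
  classical
  have hex : ∃ k : ℕ, ∃ A', Eqv A A' ∧ A' 0 0 = k :=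
    ⟨(A 0 0).toNat, A, Eqv.refl A, by have := hp.diag_pos 0; omega⟩
  obtain ⟨A', h, hk⟩ := Nat.find_spec hex
  refine ⟨A', h, fun A'' h'' => ?_⟩
  have := (h''.pd hp).diag_pos 0
  have := Nat.find_min' hex (m := (A'' 0 0).toNat) ⟨A'', h'', by omega⟩
  omega

theorem hermite (n : ℕ) : ∃ C : ℤ, 0 < C ∧ ∀ A : Matrix (Fin (n+1)) (Fin (n+1)) ℤ,
    A.IsSymm → PD A → ∃ A', Eqv A A' ∧ A' 0 0 ^ (n+1) ≤ C * A.det := by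
  induction n with
  | zero => exact ⟨1, one_pos, fun A _ _ => ⟨A, Eqv.refl A, by simp⟩⟩
  | succ n ih =>
    obtain ⟨C, hC, ih⟩ := ih
    refine ⟨4 ^ (n+1) * C, by positivity, fun A hA hp => ?_⟩
    obtain ⟨A1, h1, hmin⟩ := exists_min A hp
    have hA1 := h1.symm_of hA
    have hp1 := h1.pd hp
    have hm := hp1.diag_pos 0
    refine ⟨A1, h1, ?_⟩
    obtain ⟨B, hB, hBle⟩ := ih (schur A1) (schur_symm A1 hA1) (schur_pd A1 hA1 hp1)
    obtain ⟨A2, h2, h200, h2s, h2b⟩ := shift A1 hA1 hm B hB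
    obtain ⟨A3, h3, h300⟩ := swap_eqv A2
    have hle := hmin A3 ((h1.trans h2).trans h3)
    have hb := h2b 0
    have hBe : B 0 0 = A1 0 0 * A2 1 1 - A2 0 1 * A2 0 1 := by
      rw [← h2s]; simp [schur, h200]
    have hdet := schur_det A1 hA1
    rw [h1.det_eq] at hdet
    rw [h300] at hle
    change |2 * A2 0 1| ≤ _ at hb
    generalize A1 0 0 = m at *
    have hq : 3 * m ^ 2 ≤ 4 * B 0 0 := by
      have := abs_le.1 hb
      have h5 : (2 * A2 0 1) ^ 2 ≤ m ^ 2 := sq_le_sq' this.1 this.2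
      nlinarith
    have h6 : (3 * m ^ 2) ^ (n+1) ≤ 4 ^ (n+1) * (C * (schur A1).det) := by
      calc _ ≤ (4 * B 0 0) ^ (n+1) := pow_le_pow_left₀ (by positivity) hq _
        _ = 4 ^ (n+1) * B 0 0 ^ (n+1) := mul_pow _ _ _
        _ ≤ _ := by gcongr
    have h7 : 3 ^ (n+1) * m ^ (n+2) ≤ 4 ^ (n+1) * C * A.det := by
      have hmp : 0 < m ^ (n+1) := by positivity
      refine le_of_mul_le_mul_left ?_ hmp
      calc m ^ (n+1) * (3 ^ (n+1) * m ^ (n+2)) = (3 * m ^ 2) ^ (n+1) * m := by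
            rw [mul_pow]; ring
        _ ≤ 4 ^ (n+1) * (C * (schur A1).det) * m := by gcongr
        _ = 4 ^ (n+1) * C * ((schur A1).det * m) := by ring
        _ = _ := by rw [hdet]; ring
    refine le_trans ?_ h7
    have : (1:ℤ) ≤ 3 ^ (n+1) := one_le_pow₀ (by norm_num)
    have hmp : 0 < m ^ (n+2) := by positivity
    change m ^ (n+2) ≤ _
    nlinarith

/-- Rebuild a matrix from its first row and its Schur complement. -/
def rebuild {n : ℕ} (m : ℤ) (p : Matrix (Fin n) (Fin n) ℤ × (Fin n → ℤ)) :
    Matrix (Fin (n+1)) (Fin (n+1)) ℤ :=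
  Matrix.of fun i j => Fin.cases (Fin.cases m p.2 j)
      (fun i' => Fin.cases (p.2 i') (fun j' => (p.1 i' j' + p.2 i' * p.2 j') / m) j) i

theorem finite_classes (n : ℕ) : ∀ D : ℤ, ∃ S : Set (Matrix (Fin n) (Fin n) ℤ), S.Finite ∧
    ∀ A : Matrix (Fin n) (Fin n) ℤ, A.IsSymm → PD A → A.det = D → ∃ A' ∈ S, Eqv A A' := by
  induction n with
  | zero => exact fun D => ⟨{0}, Set.finite_singleton _, fun A _ _ _ =>
      ⟨0, rfl, by rw [Subsingleton.elim 0 A]; exact Eqv.refl A⟩⟩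
  | succ n ih =>
    intro D
    obtain ⟨C, hC, hH⟩ := hermite n
    choose S hS hS' using ih
    refine ⟨⋃ m ∈ Set.Icc (1:ℤ) (C * D), rebuild m ''
      (S (m ^ n * D / m) ×ˢ Set.Icc (fun _ => -m) (fun _ => m)), ?_, ?_⟩
    · refine Set.Finite.biUnion (Set.finite_Icc _ _) fun m _ => ?_
      exact ((hS _).prod (Set.finite_Icc _ _)).image _
    · intro A hA hp hD
      obtain ⟨A1, h1, hle⟩ := hH A hA hp
      have hA1 := h1.symm_of hA
      have hp1 := h1.pd hp
      have hm := hp1.diag_pos 0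
      have hdet := schur_det A1 hA1
      rw [h1.det_eq, hD] at hdet
      obtain ⟨B, hBS, hB⟩ := hS' (A1 0 0 ^ n * D / A1 0 0) (schur A1) (schur_symm A1 hA1)
        (schur_pd A1 hA1 hp1) (by rw [← hdet]; exact (Int.mul_ediv_cancel _ hm.ne').symm)
      obtain ⟨A2, h2, h200, h2s, h2b⟩ := shift A1 hA1 hm B hB
      have hA2 := h2.symm_of hA1
      refine ⟨A2, ?_, h1.trans h2⟩
      simp only [Set.mem_iUnion]
      refine ⟨A1 0 0, ⟨hm, ?_⟩, (B, fun i => A2 0 i.succ), ⟨hBS, ?_⟩, ?_⟩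
      · rw [← hD]
        exact le_trans (le_self_pow₀ hm (by omega)) hle
      · have hb : ∀ i : Fin n, -A1 0 0 ≤ A2 0 i.succ ∧ A2 0 i.succ ≤ A1 0 0 := by
          intro i
          have := abs_le.1 (h2b i)
          omega
        exact ⟨fun i => (hb i).1, fun i => (hb i).2⟩
      · ext i j
        refine Fin.cases ?_ (fun i => ?_) i <;> refine Fin.cases ?_ (fun j => ?_) j
        · simp [rebuild, h200]
        · simp [rebuild]
        · simp [rebuild, hA2.apply]
        · simp only [rebuild, of_apply, Fin.cases_succ]
          rw [← h2s, ← h200]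
          simp only [schur, of_apply, sub_add_cancel]
          exact Int.mul_ediv_cancel_left _ (by omega)

/-- The upper triangular coefficient matrix. -/
def upper {n : ℕ} (a : Matrix (Fin n) (Fin n) ℤ) : Matrix (Fin n) (Fin n) ℤ :=
  Matrix.of fun i j => if i ≤ j then a i j else 0

theorem Qform_eq {n : ℕ} (a : Matrix (Fin n) (Fin n) ℤ) (x : Fin n → ℤ) :
    Qform a x = x ⬝ᵥ (upper a *ᵥ x) := by
  simp only [Qform, dotProduct, mulVec, upper, of_apply, Finset.mul_sum]
  refine Finset.sum_congr rfl fun i _ => Finset.sum_congr rfl fun j _ => ?_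
  split_ifs <;> ring

theorem gram_eq {n : ℕ} (a : Matrix (Fin n) (Fin n) ℤ) : gram a = upper a + (upper a)ᵀ := by
  ext i j
  simp only [_root_.gram, of_apply, Tbil, Qform_eq, mulVec_add, add_dotProduct, dotProduct_add]
  simp
  ring

theorem gram_quad {n : ℕ} (a : Matrix (Fin n) (Fin n) ℤ) (x : Fin n → ℤ) :
    x ⬝ᵥ (gram a *ᵥ x) = 2 * Qform a x := by
  rw [gram_eq, Qform_eq, add_mulVec, dotProduct_add, mulVec_transpose, dotProduct_comm x (x ᵥ* _),
    ← dotProduct_mulVec]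
  ring

theorem gram_symm {n : ℕ} (a : Matrix (Fin n) (Fin n) ℤ) : (gram a).IsSymm := by
  rw [gram_eq, Matrix.IsSymm, transpose_add, transpose_transpose, add_comm]

/-- Coefficients of the quadratic form with Gram matrix `G`. -/
def coef {n : ℕ} (G : Matrix (Fin n) (Fin n) ℤ) : Matrix (Fin n) (Fin n) ℤ :=
  Matrix.of fun i j => if i = j then G i j / 2 else G i j

theorem gram_coef {n : ℕ} (G : Matrix (Fin n) (Fin n) ℤ) (hG : G.IsSymm)
    (he : ∀ i, 2 ∣ G i i) : gram (coef G) = G := by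
  ext i j
  rw [gram_eq]
  simp only [upper, coef, Matrix.add_apply, transpose_apply, of_apply]
  rcases lt_trichotomy i j with h | h | h
  · simp [h.le, h.not_ge, h.ne]
  · subst h
    have := he i
    simp
    omega
  · simp [h.le, h.not_ge, h.ne, hG.apply]

end Herm

open scoped Matrix
open Herm in
theorem finiteness_of_classes (n : ℕ) (hn : 0 < n) (d : ℤ) (hd : 0 < d) :
    ∃ S : Finset (Matrix (Fin n) (Fin n) ℤ),
      ∀ a : Matrix (Fin n) (Fin n) ℤ, PosDef a → HasDisc a d →
        ∃ b ∈ S, FormEquiv (Qform a) (Qform b) := by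
  classical
  obtain ⟨S, hS, h⟩ := finite_classes n (2 ^ eps n * d)
  refine ⟨hS.toFinset.image coef, fun a ha hda => ?_⟩
  obtain ⟨G, hGS, hG⟩ := h (gram a) (gram_symm a)
    (fun x hx => by rw [gram_quad]; have := ha x hx; omega) hda
  have hGs := hG.symm_of (gram_symm a)
  obtain ⟨U, hU, rfl⟩ := hG
  refine ⟨_, Finset.mem_image_of_mem _ (hS.mem_toFinset.2 hGS), ?_⟩
  have hq : ∀ x, x ⬝ᵥ ((Uᵀ * gram a * U) *ᵥ x) = 2 * Qform a (U *ᵥ x) := fun x => by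
    rw [quad_conj, gram_quad]
  refine ⟨(Matrix.GeneralLinearGroup.mk'' U hU)⁻¹, fun x => ?_⟩
  rw [inv_inv]
  change _ = Qform a (U *ᵥ x)
  have h1 := gram_quad (coef (Uᵀ * gram a * U)) x
  rw [gram_coef _ hGs, hq] at h1
  · omega
  · intro i
    have := hq (Pi.single i 1)
    exact ⟨Qform a (U *ᵥ Pi.single i 1), by rw [← this]; simp⟩
end

section
/- Every positive definite integral quadratic form in 8 variables with discriminant 1 is GL_8(ℤ)-equivalent to the form E_8(x) := (∑_{1≤i≤j≤8} x_i x_j) − x_1x_2 − x_2x_3. -/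
open scoped BigOperators

/-- Mordell's form `E₈(x) = (∑_{1 ≤ i ≤ j ≤ 8} x_i x_j) - x₁x₂ - x₂x₃`. -/
def E8form (x : Fin 8 → ℤ) : ℤ :=
  (∑ i, ∑ j, if i ≤ j then x i * x j else 0) - x 0 * x 1 - x 1 * x 2


namespace MordellE8

open MeasureTheory

/-- The convex body: a box in the first `k` coordinates times a ball in the others. -/
def body8 (k : ℕ) : Set (Fin 8 → ℝ) :=
  {y | (∀ i : Fin 8, i.val < k → |y i| < √2) ∧ ∑ i : Fin 8, (if i.val < k then 0 else y i ^ 2) < 4}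

lemma ball_vol (ι : Type) [Fintype ι] [Nonempty ι] :
    volume {y : ι → ℝ | ∑ i, y i ^ 2 < 4} =
      ENNReal.ofReal (2 ^ Fintype.card ι * (√Real.pi ^ Fintype.card ι /
        Real.Gamma (Fintype.card ι / 2 + 1))) := by
  have h := EuclideanSpace.volume_ball ι (0 : EuclideanSpace ℝ ι) 2
  rw [← (PiLp.volume_preserving_toLp ι).measure_preimage
      measurableSet_ball.nullMeasurableSet] at h
  rw [ENNReal.ofReal_mul (by positivity), ENNReal.ofReal_pow (by norm_num), ← h]
  congr 1
  ext y
  simp only [Set.mem_preimage, Metric.mem_ball, dist_zero_right, Set.mem_ofPred_eq,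
    EuclideanSpace.norm_eq, Real.norm_eq_abs, sq_abs]
  rw [Real.sqrt_lt' (by norm_num)]
  norm_num

lemma body8_vol_eq (k : ℕ) (hk : k < 8) :
    volume (body8 k) = ENNReal.ofReal ((2 * √2) ^ k * (2 ^ (8 - k) * (√Real.pi ^ (8 - k) /
        Real.Gamma (((8 - k : ℕ) : ℝ) / 2 + 1)))) := by
  have e := volume_preserving_piEquivPiSubtypeProd (fun _ : Fin 8 => ℝ) (fun i => i.val < k)
  have c1 : Fintype.card {i : Fin 8 // i.val < k} = k := by
    rw [Fintype.card_subtype]; interval_cases k <;> decide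
  have c2 : Fintype.card {i : Fin 8 // ¬ i.val < k} = 8 - k := by
    rw [Fintype.card_subtype]; interval_cases k <;> decide
  have : Nonempty {i : Fin 8 // ¬ i.val < k} := ⟨⟨⟨k, hk⟩, by simp⟩⟩
  have hb : body8 k = (MeasurableEquiv.piEquivPiSubtypeProd (fun _ : Fin 8 => ℝ)
      (fun i => i.val < k)) ⁻¹' ((Set.univ.pi fun _ => Set.Ioo (-√2) √2) ×ˢ
        {y | ∑ i, y i ^ 2 < 4}) := by
    ext y
    simp only [body8, Set.mem_ofPred_eq, Set.mem_preimage, Set.mem_prod, Set.mem_pi, Set.mem_univ,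
      true_imp_iff, MeasurableEquiv.piEquivPiSubtypeProd_apply, Set.mem_Ioo, abs_lt, Subtype.forall]
    refine and_congr Iff.rfl ?_
    have : ∑ i : Fin 8, (if i.val < k then 0 else y i ^ 2) =
      ∑ i : {i : Fin 8 // ¬ i.val < k}, y i ^ 2 := by
      rw [← Finset.sum_subtype (Finset.univ.filter fun i : Fin 8 => ¬ i.val < k) (by simp)
        (fun i => y i ^ 2), Finset.sum_filter]
      refine Finset.sum_congr rfl fun i _ => ?_
      by_cases h : i.val < k <;> simp [h]
    rw [this]
  rw [hb, e.measure_preimage_equiv, Measure.volume_eq_prod, Measure.prod_prod, ball_vol, c2,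
    volume_pi_pi]
  simp only [Real.volume_Ioo, Finset.prod_const, Finset.card_univ, c1]
  rw [ENNReal.ofReal_mul (p := (2 * √2) ^ k) (by positivity),
    ENNReal.ofReal_pow (by positivity), sub_neg_eq_add,
    ← two_mul]

lemma body8_vol (k : ℕ) (hk : k < 8) :
    ENNReal.ofReal (2 ^ 8 * 2 ^ min k 4) < volume (body8 k) := by
  rw [body8_vol_eq k hk]
  have hpi := Real.pi_gt_d2
  have hpp : √Real.pi ^ 2 = Real.pi := Real.sq_sqrt Real.pi_pos.le
  have hs : √(2:ℝ) ^ 2 = 2 := Real.sq_sqrt (by norm_num)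
  have hs1 : (1.41:ℝ) < √2 := by rw [Real.lt_sqrt (by norm_num)]; norm_num
  have hp0 : √Real.pi ≠ 0 := by positivity
  have g (n : ℕ) : Real.Gamma ((n + 1 : ℝ) / 2 + 1) = (n + 1) / 2 * Real.Gamma ((n + 1 : ℝ) / 2) :=
    Real.Gamma_add_one (by positivity)
  have G1 : Real.Gamma (3/2) = √Real.pi / 2 := by
    have := Real.Gamma_add_one (s := 1/2) (by norm_num)
    rw [Real.Gamma_one_half_eq] at this; norm_num at this; rw [this]; ring
  have G3 : Real.Gamma (5/2) = √Real.pi * (3 / 4) := by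
    have := Real.Gamma_add_one (s := 3/2) (by norm_num)
    rw [G1] at this; norm_num at this; rw [this]; ring
  have G5 : Real.Gamma (7/2) = √Real.pi * (15 / 8) := by
    have := Real.Gamma_add_one (s := 5/2) (by norm_num)
    rw [G3] at this; norm_num at this; rw [this]; ring
  have G7 : Real.Gamma (9/2) = √Real.pi * (105 / 16) := by
    have := Real.Gamma_add_one (s := 7/2) (by norm_num)
    rw [G5] at this; norm_num at this; rw [this]; ring
  have N (n : ℕ) := Real.Gamma_nat_eq_factorial n
  have G2 : Real.Gamma 2 = 1 := by have := N 1; norm_num at this; simp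
  have G4 : Real.Gamma 3 = 2 := by have := N 2; norm_num at this; simp [Nat.factorial]
  have G6 : Real.Gamma 4 = 6 := by have := N 3; norm_num at this; simp [Nat.factorial]
  have G8 : Real.Gamma 5 = 24 := by have := N 4; norm_num at this; simp [Nat.factorial]
  have P2 : 3.14 ^ 2 < Real.pi ^ 2 := by gcongr
  have P3 : 3.14 ^ 3 < Real.pi ^ 3 := by gcongr
  have P4 : 3.14 ^ 4 < Real.pi ^ 4 := by gcongr
  have e2 : √Real.pi ^ 2 = Real.pi := hpp
  have e4 : √Real.pi ^ 4 = Real.pi ^ 2 := by rw [show 4 = 2 * 2 by rfl, pow_mul, hpp]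
  have e6 : √Real.pi ^ 6 = Real.pi ^ 3 := by rw [show 6 = 2 * 3 by rfl, pow_mul, hpp]
  have e8 : √Real.pi ^ 8 = Real.pi ^ 4 := by rw [show 8 = 2 * 4 by rfl, pow_mul, hpp]
  have e3 : √Real.pi ^ 3 = √Real.pi * Real.pi := by rw [pow_succ', e2]
  have e5 : √Real.pi ^ 5 = √Real.pi * Real.pi ^ 2 := by rw [pow_succ', e4]
  have e7 : √Real.pi ^ 7 = √Real.pi * Real.pi ^ 3 := by rw [pow_succ', e6]
  have q1 : 1.41 * 3.14 < √2 * Real.pi := by gcongr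
  have q2 : 1.41 * 3.14 ^ 2 < √2 * Real.pi ^ 2 := by gcongr
  have q3 : 1.41 * 3.14 ^ 3 < √2 * Real.pi ^ 3 := by gcongr
  have s2 : (2 * √(2:ℝ)) ^ 2 = 8 := by rw [mul_pow, hs]; norm_num
  have s4 : (2 * √(2:ℝ)) ^ 4 = 64 := by rw [show 4 = 2 * 2 by rfl, pow_mul, s2]; norm_num
  have s6 : (2 * √(2:ℝ)) ^ 6 = 512 := by rw [show 6 = 2 * 3 by rfl, pow_mul, s2]; norm_num
  have s3 : (2 * √(2:ℝ)) ^ 3 = 16 * √2 := by rw [pow_succ, s2]; ring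
  have s5 : (2 * √(2:ℝ)) ^ 5 = 128 * √2 := by rw [pow_succ, s4]; ring
  have s7 : (2 * √(2:ℝ)) ^ 7 = 1024 * √2 := by rw [pow_succ, s6]; ring
  apply (ENNReal.ofReal_lt_ofReal_iff_of_nonneg (by positivity)).2
  interval_cases k
  · norm_num [G8, e8]; linarith
  · norm_num [G7, e7]; rw [mul_div_mul_left _ _ hp0]; nlinarith [q3]
  · norm_num [G6, e6, s2]; linarith
  · norm_num [G5, e5, s3]; rw [mul_div_mul_left _ _ hp0]; nlinarith [q2]
  · norm_num [G4, e4, s4]; linarith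
  · norm_num [G3, e3, s5]; rw [mul_div_mul_left _ _ hp0]; nlinarith [q1]
  · norm_num [G2, e2, s6]; linarith
  · norm_num [G1, s7]; rw [div_div_cancel₀ hp0]; linarith

/-- coordinatewise cast `ℤ⁸ → ℝ⁸`. -/
def castV : (Fin 8 → ℤ) →ₗ[ℤ] (Fin 8 → ℝ) where
  toFun x i := (x i : ℝ)
  map_add' x y := by ext; simp
  map_smul' x y := by ext; simp

lemma castV_apply (x : Fin 8 → ℤ) (i : Fin 8) : castV x i = (x i : ℝ) := rfl

lemma castV_inj : Function.Injective castV := fun x y h => by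
  ext i
  have := congrFun h i
  simpa [castV_apply] using this

lemma castV_range : LinearMap.range castV =
    Submodule.span ℤ (Set.range (Pi.basisFun ℝ (Fin 8))) := by
  apply le_antisymm
  · rintro _ ⟨x, rfl⟩
    have : castV x = ∑ i, x i • Pi.basisFun ℝ (Fin 8) i := by
      ext j
      simp [castV_apply, Finset.sum_apply, Pi.single_apply]
    rw [this]
    exact Submodule.sum_mem _ fun i _ => Submodule.smul_mem _ _ (Submodule.subset_span ⟨i, rfl⟩)
  · rw [Submodule.span_le]
    rintro _ ⟨i, rfl⟩
    refine ⟨Pi.single i 1, ?_⟩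
    ext j
    simp [castV_apply, Pi.single_apply]

lemma mink (K : Submodule ℤ (Fin 8 → ℤ)) (h2 : ∀ x, (2 : ℤ) • x ∈ K) (m : ℕ)
    (hm : K.toAddSubgroup.index ≤ m) (T : Matrix (Fin 8) (Fin 8) ℝ) (hT : |T.det| = 1)
    (s : Set (Fin 8 → ℝ)) (hc : Convex ℝ s) (hs : ∀ x ∈ s, -x ∈ s)
    (hv : ENNReal.ofReal (2 ^ 8 * m) < volume s) :
    ∃ x ∈ K, x ≠ 0 ∧ T.mulVec (castV x) ∈ s := by
  have hT0 : LinearMap.det (Matrix.toLin' T) ≠ 0 := by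
    rw [LinearMap.det_toLin']; intro h; simp [h] at hT
  have hvol : volume (Matrix.toLin' T ⁻¹' s) = volume s := by
    rw [Measure.addHaar_preimage_linearMap _ hT0, LinearMap.det_toLin', abs_inv, hT]
    simp
  set L2 := Submodule.span ℤ (Set.range (Pi.basisFun ℝ (Fin 8))) with hL2
  set L1 := K.map castV with hL1
  have hle : L1 ≤ L2 := by
    rw [hL2, ← castV_range]; exact LinearMap.map_le_range
  have : DiscreteTopology L1 := DiscreteTopology.of_subset (s := (L2 : Set (Fin 8 → ℝ)))
    (inferInstanceAs (DiscreteTopology L2)) hle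
  have : IsZLattice ℝ L1 := by
    constructor
    rw [eq_top_iff, ← (Pi.basisFun ℝ (Fin 8)).span_eq, Submodule.span_le]
    rintro _ ⟨i, rfl⟩
    have : (2:ℝ)⁻¹ • castV ((2:ℤ) • Pi.single i 1) ∈ Submodule.span ℝ (L1 : Set (Fin 8 → ℝ)) :=
      Submodule.smul_mem _ _ (Submodule.subset_span ⟨_, h2 _, rfl⟩)
    have e : Pi.basisFun ℝ (Fin 8) i = (2:ℝ)⁻¹ • castV ((2:ℤ) • Pi.single i 1) := ?_
    · rw [e]; exact this
    ext j
    by_cases h : j = i <;> simp [castV_apply, h]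
  have c2 : ZLattice.covolume L2 = 1 := by
    rw [ZLattice.covolume_eq_measure_fundamentalDomain L2 volume
      (ZSpan.isAddFundamentalDomain (Pi.basisFun ℝ (Fin 8)) volume), ZSpan.fundamentalDomain_pi_basisFun,
      measureReal_def, volume_pi_pi]
    simp
  have c1 : ZLattice.covolume L1 ≤ m := by
    have := ZLattice.covolume_div_covolume_eq_relIndex L1 L2 hle
    rw [c2, div_one] at this
    rw [this]
    have e : L1.toAddSubgroup.relIndex L2.toAddSubgroup = K.toAddSubgroup.index := by
      have e1 : L1.toAddSubgroup = K.toAddSubgroup.map castV.toAddMonoidHom := rfl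
      have e2 : L2.toAddSubgroup = (⊤ : AddSubgroup _).map castV.toAddMonoidHom := by
        rw [hL2, ← castV_range]; ext x; simp
      rw [e1, e2, AddSubgroup.relIndex_map_map_of_injective _ _ castV_inj,
        AddSubgroup.relIndex_top_right]
    rw [e]
    exact_mod_cast hm
  have fund := ZLattice.isAddFundamentalDomain (Module.Free.chooseBasis ℤ L1) (volume : Measure (Fin 8 → ℝ))
  have hcov := ZLattice.covolume_eq_measure_fundamentalDomain L1 volume fund
  have hfin := (ZSpan.fundamentalDomain_isBounded ((Module.Free.chooseBasis ℤ L1).ofZLatticeBasis ℝ)).measure_lt_top (μ := volume)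
  have : Countable L1.toAddSubgroup :=
    Function.Surjective.countable (f := fun x : K => (⟨castV x, ⟨x, x.2, rfl⟩⟩ : L1)) (by
      rintro ⟨_, x, hx, rfl⟩
      exact ⟨⟨x, hx⟩, rfl⟩)
  have key := exists_ne_zero_mem_lattice_of_measure_mul_two_pow_lt_measure (L := L1.toAddSubgroup)
    (s := Matrix.toLin' T ⁻¹' s) fund (fun x hx => by
      simp only [Set.mem_preimage, map_neg] at hx ⊢; exact hs _ hx) (hc.linear_preimage _) (by
      rw [hvol]
      refine lt_of_le_of_lt ?_ hv
      rw [← ENNReal.ofReal_toReal hfin.ne, ← measureReal_def, ← hcov, mul_comm,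
        ENNReal.ofReal_mul (by positivity)]
      gcongr
      simp)
  obtain ⟨⟨y, hy⟩, hy0, hys⟩ := key
  obtain ⟨x, hx, rfl⟩ := hy
  refine ⟨x, hx, ?_, hys⟩
  rintro rfl
  exact hy0 (by ext; simp)
open Matrix

lemma psd_real (G : Matrix (Fin 8) (Fin 8) ℤ) (hsym : Gᵀ = G)
    (hpos : ∀ x : Fin 8 → ℤ, x ≠ 0 → 0 < x ⬝ᵥ G *ᵥ x) :
    (G.map (Int.cast : ℤ → ℝ)).PosSemidef := by
  refine PosSemidef.of_dotProduct_mulVec_nonneg ?_ ?_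
  · rw [IsHermitian, conjTranspose_eq_transpose_of_trivial, ← transpose_map, hsym]
  · have hd : DenseRange (Pi.map (fun (_ : Fin 8) (q : ℚ) => (q : ℝ))) :=
      DenseRange.piMap fun _ => Rat.denseRange_cast
    intro x
    have hcl : IsClosed {x : Fin 8 → ℝ | 0 ≤ star x ⬝ᵥ (G.map (Int.cast : ℤ → ℝ)) *ᵥ x} := by
      refine isClosed_le continuous_const ?_
      simp only [dotProduct, mulVec]
      fun_prop
    refine hd.induction_on (p := fun x => 0 ≤ star x ⬝ᵥ (G.map (Int.cast : ℤ → ℝ)) *ᵥ x) x hcl ?_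
    intro q
    obtain ⟨d, hd0, hdq⟩ : ∃ d : ℕ, 0 < d ∧ ∀ i, ∃ z : ℤ, (d : ℚ) * q i = z := by
      refine ⟨∏ i, (q i).den, Finset.prod_pos fun i _ => (q i).pos, fun i => ?_⟩
      obtain ⟨c, hc⟩ := Finset.dvd_prod_of_mem (fun i => (q i).den) (Finset.mem_univ i)
      refine ⟨c * (q i).num, ?_⟩
      rw [hc]
      push_cast
      rw [mul_comm ((q i).den : ℚ), mul_assoc, Rat.den_mul_eq_num]
    choose z hz using hdq
    have hzn : (0:ℤ) ≤ z ⬝ᵥ G *ᵥ z := by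
      by_cases h : z = 0
      · simp [h]
      · exact (hpos z h).le
    have hx : Pi.map (fun (_ : Fin 8) (q : ℚ) => (q : ℝ)) q = (d : ℝ)⁻¹ • castV z := by
      ext i
      have : (d : ℝ) * (q i : ℝ) = z i := by exact_mod_cast hz i
      have hd' : (d : ℝ) ≠ 0 := by positivity
      simp [castV_apply, Pi.map_apply, ← this, hd']
    rw [hx]
    have e : castV z ⬝ᵥ (G.map (Int.cast : ℤ → ℝ)) *ᵥ castV z = ((z ⬝ᵥ G *ᵥ z : ℤ) : ℝ) := by
      simp [dotProduct, mulVec, castV_apply]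
    simp only [star_trivial, smul_dotProduct, mulVec_smul, dotProduct_smul, e, smul_eq_mul]
    have : (0:ℝ) ≤ ((z ⬝ᵥ G *ᵥ z : ℤ) : ℝ) := by exact_mod_cast hzn
    positivity

lemma castV_mulVec (M : Matrix (Fin 8) (Fin 8) ℤ) (x : Fin 8 → ℤ) :
    castV (M *ᵥ x) = M.map (Int.cast : ℤ → ℝ) *ᵥ castV x := by
  ext i
  simp [castV_apply, mulVec, dotProduct]

open scoped MatrixOrder in
lemma exists_T (G : Matrix (Fin 8) (Fin 8) ℤ) (hsym : Gᵀ = G)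
    (hpos : ∀ x : Fin 8 → ℤ, x ≠ 0 → 0 < x ⬝ᵥ G *ᵥ x) (R : Matrix (Fin 8) (Fin 8) ℤ) (k : ℕ)
    (hR : Rᵀ * G * R = diagonal (fun i : Fin 8 => if i.val < k then 2 else 0)) :
    ∃ T : Matrix (Fin 8) (Fin 8) ℝ, Tᵀ * T = G.map (Int.cast : ℤ → ℝ) ∧
      ∀ i : Fin 8, i.val < k → ∀ x : Fin 8 → ℤ,
        √2 * (T *ᵥ castV x) i = (((Rᵀ * G) *ᵥ x) i : ℤ) := by
  obtain ⟨A, hA⟩ := CStarAlgebra.nonneg_iff_eq_star_mul_self.mp (psd_real G hsym hpos).nonneg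
  rw [star_eq_conjTranspose, conjTranspose_eq_transpose_of_trivial] at hA
  have hAxy (x y : Fin 8 → ℤ) : (A *ᵥ castV x) ⬝ᵥ (A *ᵥ castV y) = ((x ⬝ᵥ G *ᵥ y : ℤ) : ℝ) := by
    rw [dotProduct_mulVec, vecMul_mulVec, ← hA, ← dotProduct_mulVec, ← castV_mulVec]
    simp [dotProduct, castV_apply]
  have hRe (i j : Fin 8) : (fun l => R l i) ⬝ᵥ G *ᵥ (fun l => R l j) =
      if i = j then (if i.val < k then 2 else 0) else 0 := by
    have := congrFun (congrFun hR i) j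
    rw [diagonal_apply, Matrix.mul_assoc] at this
    rw [← this]
    rfl
  have s2 : √(2:ℝ) * √2 = 2 := Real.mul_self_sqrt (by norm_num)
  have s0 : √(2:ℝ) ≠ 0 := by positivity
  let v : Fin 8 → EuclideanSpace ℝ (Fin 8) := fun i =>
    WithLp.toLp 2 ((√2)⁻¹ • A *ᵥ castV (fun l => R l i))
  have hv : Orthonormal ℝ (({i : Fin 8 | i.val < k}).domRestrict v) := by
    rw [orthonormal_iff_ite]
    rintro ⟨i, hi⟩ ⟨j, hj⟩
    simp only [Set.mem_ofPred_eq] at hi hj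
    simp only [Set.domRestrict_apply, v, EuclideanSpace.inner_eq_star_dotProduct, star_trivial,
      smul_dotProduct, dotProduct_smul, hAxy, hRe, Subtype.mk.injEq]
    by_cases h : i = j
    · subst h
      simp [hi]
      field_simp
      rw [pow_two, s2]
    · simp [h, Ne.symm h]
  obtain ⟨b, hb⟩ := hv.exists_orthonormalBasis_extension_of_card_eq (by simp)
  let B : Matrix (Fin 8) (Fin 8) ℝ := Matrix.of fun i j => b i j
  have hB : B * Bᵀ = 1 := by
    ext i j
    have := orthonormal_iff_ite.1 b.orthonormal i j
    rw [EuclideanSpace.inner_eq_star_dotProduct, star_trivial, dotProduct_comm] at this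
    rw [one_apply, ← this]
    rfl
  have hB' : Bᵀ * B = 1 := mul_eq_one_comm.1 hB
  refine ⟨B * A, ?_, ?_⟩
  · rw [transpose_mul, Matrix.mul_assoc, ← Matrix.mul_assoc Bᵀ, hB', Matrix.one_mul, hA]
  · intro i hi x
    have h1 : ((B * A) *ᵥ castV x) i = (b i).ofLp ⬝ᵥ (A *ᵥ castV x) := by
      rw [← mulVec_mulVec]; rfl
    rw [h1, hb i hi]
    simp only [v, smul_dotProduct, hAxy, smul_eq_mul]
    rw [mul_inv_cancel_left₀ s0, ← mulVec_mulVec]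
    rfl

/-- The mod 2 reduction of `Rᵀ G`. -/
def Wmat (G R : Matrix (Fin 8) (Fin 8) ℤ) : Matrix (Fin 8) (Fin 8) (ZMod 2) :=
  (Rᵀ * G).map (Int.cast : ℤ → ZMod 2)

lemma Wmat_eq (G R : Matrix (Fin 8) (Fin 8) ℤ) :
    Wmat G R = (R.map (Int.cast : ℤ → ZMod 2))ᵀ * G.map (Int.cast : ℤ → ZMod 2) := by
  have := Matrix.map_mul (L := Rᵀ) (M := G) (f := Int.castRingHom (ZMod 2))
  exact this

lemma Wmat_rank (G R : Matrix (Fin 8) (Fin 8) ℤ) (hdet : G.det = 1) :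
    (Wmat G R).rank = (R.map (Int.cast : ℤ → ZMod 2)).rank := by
  rw [Wmat_eq, rank_mul_eq_left_of_isUnit_det, rank_transpose]
  have h : (G.map (Int.cast : ℤ → ZMod 2)).det = ((G.det : ℤ) : ZMod 2) :=
    ((Int.castRingHom (ZMod 2)).map_det G).symm
  rw [h, hdet]
  simp

lemma Wmat_mulVec (G R : Matrix (Fin 8) (Fin 8) ℤ) (x : Fin 8 → ℤ) (i : Fin 8) :
    (Wmat G R *ᵥ (fun j => (x j : ZMod 2))) i = ((((Rᵀ * G) *ᵥ x) i : ℤ) : ZMod 2) := by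
  simp [Wmat, mulVec, dotProduct]

/-- The sublattice of vectors having even inner product with all columns of `R`. -/
def evenSub (G R : Matrix (Fin 8) (Fin 8) ℤ) : Submodule ℤ (Fin 8 → ℤ) where
  carrier := {x | ∀ i, (2 : ℤ) ∣ ((Rᵀ * G) *ᵥ x) i}
  add_mem' {x y} hx hy i := by
    rw [mulVec_add]; exact dvd_add (hx i) (hy i)
  zero_mem' i := by simp
  smul_mem' c x hx i := by
    rw [mulVec_smul]; exact Dvd.dvd.mul_left (hx i) c

lemma evenSub_index (G R : Matrix (Fin 8) (Fin 8) ℤ) (hdet : G.det = 1) (k : ℕ)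
    (hR : Rᵀ * G * R = diagonal (fun i : Fin 8 => if i.val < k then 2 else 0))
    (hR0 : ∀ i : Fin 8, k ≤ i.val → ∀ l, R l i = 0) (hk : k < 8) :
    (evenSub G R).toAddSubgroup.index ≤ 2 ^ min k 4 := by
  have hz : Wmat G R * R.map (Int.cast : ℤ → ZMod 2) = 0 := by
    have h := Matrix.map_mul (L := Rᵀ * G) (M := R) (f := Int.castRingHom (ZMod 2))
    refine Eq.trans h.symm ?_
    rw [hR]
    ext i j
    by_cases h : i = j
    · subst h
      by_cases h' : i.val < k
      · simp [h']; rfl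
      · simp [h']
    · simp [diagonal_apply_ne _ h]
  have r1 : (Wmat G R).rank ≤ 4 := by
    have := rank_add_rank_le_card_of_mul_eq_zero hz
    rw [← Wmat_rank G R hdet] at this
    simp at this
    omega
  have r2 : (Wmat G R).rank ≤ k := by
    rw [Wmat_rank G R hdet]
    have : R.map (Int.cast : ℤ → ZMod 2) = R.map (Int.cast : ℤ → ZMod 2) *
        diagonal (fun i : Fin 8 => if i.val < k then (1 : ZMod 2) else 0) := by
      ext i j
      rw [mul_diagonal]
      by_cases h : j.val < k
      · simp [h]
      · simp [h, hR0 j (not_lt.1 h) i]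
    rw [this]
    refine (rank_mul_le_right _ _).trans ?_
    rw [rank_diagonal, Fintype.card_subtype]
    interval_cases k <;> decide
  let φ : (Fin 8 → ℤ) →+ (Fin 8 → ZMod 2) :=
    { toFun := fun x => Wmat G R *ᵥ (fun j => (x j : ZMod 2))
      map_zero' := by ext i; simp [mulVec, dotProduct]
      map_add' := fun x y => by rw [← mulVec_add]; congr 1; ext j; simp }
  have hker : (evenSub G R).toAddSubgroup = φ.ker := by
    ext x
    rw [AddMonoidHom.mem_ker]
    constructor
    · intro hx
      ext i
      refine (Wmat_mulVec G R x i).trans ?_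
      exact (ZMod.intCast_zmod_eq_zero_iff_dvd _ 2).2 (hx i)
    · intro hx i
      have := congrFun hx i
      exact (ZMod.intCast_zmod_eq_zero_iff_dvd _ 2).1 ((Wmat_mulVec G R x i).symm.trans this)
  rw [hker, AddSubgroup.index_ker]
  have h1 : Nat.card φ.range ≤ Nat.card (LinearMap.range (Wmat G R).mulVecLin) := by
    refine Nat.card_mono (s := (φ.range : Set (Fin 8 → ZMod 2)))
      (t := ((LinearMap.range (Wmat G R).mulVecLin : Submodule (ZMod 2) (Fin 8 → ZMod 2)) :
        Set (Fin 8 → ZMod 2))) (Set.toFinite _) ?_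
    rintro _ ⟨x, rfl⟩
    exact ⟨_, rfl⟩
  refine h1.trans ?_
  rw [Module.natCard_eq_pow_finrank (K := ZMod 2), Nat.card_zmod]
  exact Nat.pow_le_pow_right (by norm_num) (le_min r2 r1)

lemma body8_convex (k : ℕ) : Convex ℝ (body8 k) := by
  have h1 : Convex ℝ {y : Fin 8 → ℝ | ∀ i : Fin 8, i.val < k → |y i| < √2} := by
    intro x hx y hy a b ha hb hab i hi
    have h := convex_Ioo (-√2) √2 (abs_lt.1 (hx i hi)) (abs_lt.1 (hy i hi)) ha hb hab
    exact abs_lt.2 h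
  have h2 : ConvexOn ℝ Set.univ
      (fun y : Fin 8 → ℝ => ∑ i : Fin 8, (if i.val < k then 0 else y i ^ 2)) := by
    refine ⟨convex_univ, fun x _ y _ a b ha hb hab => ?_⟩
    simp only [smul_eq_mul, Finset.mul_sum, ← Finset.sum_add_distrib]
    refine Finset.sum_le_sum fun i _ => ?_
    by_cases h : i.val < k
    · simp [h]
    · simp only [h, if_false]
      exact (even_two.convexOn_pow (𝕜 := ℝ)).2 trivial trivial ha hb hab
  have h3 := h2.convex_lt 4
  simp only [Set.mem_univ, true_and] at h3
  exact h1.inter h3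

lemma body8_symm (k : ℕ) (x : Fin 8 → ℝ) (hx : x ∈ body8 k) : -x ∈ body8 k := by
  refine ⟨fun i hi => ?_, ?_⟩
  · simpa using hx.1 i hi
  · simpa using hx.2

lemma step (G R : Matrix (Fin 8) (Fin 8) ℤ) (hsym : Gᵀ = G) (hdet : G.det = 1)
    (hpos : ∀ x : Fin 8 → ℤ, x ≠ 0 → 0 < x ⬝ᵥ G *ᵥ x)
    (heven : ∀ x : Fin 8 → ℤ, (2 : ℤ) ∣ x ⬝ᵥ G *ᵥ x) (k : ℕ)
    (hR : Rᵀ * G * R = diagonal (fun i : Fin 8 => if i.val < k then 2 else 0))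
    (hR0 : ∀ i : Fin 8, k ≤ i.val → ∀ l, R l i = 0) (hk : k < 8) :
    ∃ x : Fin 8 → ℤ, (Rᵀ * G) *ᵥ x = 0 ∧ x ⬝ᵥ G *ᵥ x = 2 := by
  obtain ⟨T, hT, hTR⟩ := exists_T G hsym hpos R k hR
  have hTdet : |T.det| = 1 := by
    have h : (G.map (Int.cast : ℤ → ℝ)).det = ((G.det : ℤ) : ℝ) :=
      ((Int.castRingHom ℝ).map_det G).symm
    have h2 := congrArg det hT
    rw [det_mul, det_transpose, h, hdet, Int.cast_one] at h2
    have h3 : |T.det| * |T.det| = 1 := by rw [← abs_mul, h2, abs_one]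
    nlinarith [abs_nonneg T.det]
  obtain ⟨x, hxK, hx0, hxs⟩ := mink (evenSub G R) (fun x i => by
      rw [mulVec_smul]; exact Dvd.intro _ rfl) (2 ^ min k 4)
    (evenSub_index G R hdet k hR hR0 hk) T hTdet (body8 k) (body8_convex k) (body8_symm k)
    (by have := body8_vol k hk; push_cast; exact this)
  have s0 : (0:ℝ) < √2 := by positivity
  have s2 : √(2:ℝ) * √2 = 2 := Real.mul_self_sqrt (by norm_num)
  have hz : ∀ i, ((Rᵀ * G) *ᵥ x) i = 0 := by
    intro i
    by_cases h : i.val < k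
    · have h1 := hTR i h x
      have h2 : |√2 * (T *ᵥ castV x) i| < 2 := by
        rw [abs_mul, abs_of_pos s0]
        calc _ < √2 * √2 := by gcongr; exact hxs.1 i h
          _ = 2 := s2
      rw [h1] at h2
      have h3 : |((Rᵀ * G) *ᵥ x) i| < 2 := by exact_mod_cast h2
      exact Int.eq_zero_of_abs_lt_dvd (hxK i) h3
    · rw [← mulVec_mulVec]
      simp [mulVec, dotProduct, hR0 i (not_lt.1 h)]
  refine ⟨x, funext hz, ?_⟩
  have hTz (i : Fin 8) (h : i.val < k) : (T *ᵥ castV x) i = 0 := by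
    have h1 := hTR i h x
    rw [hz i, Int.cast_zero, mul_eq_zero] at h1
    exact h1.resolve_left s0.ne'
  have hn : ((x ⬝ᵥ G *ᵥ x : ℤ) : ℝ) < 4 := by
    have e1 : ((x ⬝ᵥ G *ᵥ x : ℤ) : ℝ) = castV x ⬝ᵥ (castV (G *ᵥ x)) := by
      simp [dotProduct, castV_apply]
    have e2 : castV x ⬝ᵥ (castV (G *ᵥ x)) = (T *ᵥ castV x) ⬝ᵥ (T *ᵥ castV x) := by
      rw [castV_mulVec, ← hT, dotProduct_mulVec (T *ᵥ castV x), vecMul_mulVec, ← dotProduct_mulVec]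
    rw [e1, e2]
    refine lt_of_le_of_lt (le_of_eq ?_) hxs.2
    refine Finset.sum_congr rfl fun i _ => ?_
    by_cases h : i.val < k
    · simp [h, hTz i h]
    · simp [h, pow_two]
  have hn' : x ⬝ᵥ G *ᵥ x < 4 := by exact_mod_cast hn
  have := hpos x hx0
  have := heven x
  omega

lemma exists_frame (G : Matrix (Fin 8) (Fin 8) ℤ) (hsym : Gᵀ = G) (hdet : G.det = 1)
    (hpos : ∀ x : Fin 8 → ℤ, x ≠ 0 → 0 < x ⬝ᵥ G *ᵥ x)
    (heven : ∀ x : Fin 8 → ℤ, (2 : ℤ) ∣ x ⬝ᵥ G *ᵥ x) (k : ℕ) (hk : k ≤ 8) :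
    ∃ R : Matrix (Fin 8) (Fin 8) ℤ,
      Rᵀ * G * R = diagonal (fun i : Fin 8 => if i.val < k then 2 else 0) ∧
      ∀ i : Fin 8, k ≤ i.val → ∀ l, R l i = 0 := by
  induction k with
  | zero => exact ⟨0, by simp, by simp⟩
  | succ k ih =>
    have hk8 : k < 8 := by omega
    obtain ⟨R, hR, hR0⟩ := ih (by omega)
    obtain ⟨x, hx, hx2⟩ := step G R hsym hdet hpos heven k hR hR0 (by omega)
    have gen (M : Matrix (Fin 8) (Fin 8) ℤ) (i j : Fin 8) :
        (Mᵀ * G * M) i j = (fun l => M l i) ⬝ᵥ G *ᵥ (fun l => M l j) := by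
      rw [Matrix.mul_assoc]; rfl
    have hRx (i : Fin 8) : (fun l => R l i) ⬝ᵥ G *ᵥ x = 0 := by
      have := congrFun hx i
      rw [← mulVec_mulVec] at this
      exact this
    have hxR (i : Fin 8) : x ⬝ᵥ G *ᵥ (fun l => R l i) = 0 := by
      rw [dotProduct_mulVec, ← mulVec_transpose, hsym, dotProduct_comm]; exact hRx i
    have c1 : (fun l => R.updateCol ⟨k, hk8⟩ x l ⟨k, hk8⟩) = x := by
      ext l; simp
    have c2 (i : Fin 8) (h : i ≠ ⟨k, hk8⟩) :
        (fun l => R.updateCol ⟨k, hk8⟩ x l i) = fun l => R l i := by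
      ext l; simp [updateCol_ne h]
    refine ⟨R.updateCol ⟨k, hk8⟩ x, ?_, ?_⟩
    · ext i j
      rw [gen, diagonal_apply]
      have hij := congrFun (congrFun hR i) j
      rw [gen, diagonal_apply] at hij
      by_cases hi : i = ⟨k, hk8⟩
      · by_cases hj : j = ⟨k, hk8⟩
        · subst hi; subst hj
          rw [c1, hx2]; simp
        · have : i ≠ j := fun h => hj (h ▸ hi)
          rw [c2 j hj, if_neg this, hi, c1, hxR]
      · by_cases hj : j = ⟨k, hk8⟩
        · have : i ≠ j := fun h => hi (h ▸ hj)
          rw [c2 i hi, if_neg this, hj, c1, hRx]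
        · rw [c2 i hi, c2 j hj, hij]
          have : i.val ≠ k := fun h => hi (Fin.ext h)
          have : i.val < k ↔ i.val < k + 1 := by omega
          simp [this]
    · intro i hi l
      have : i ≠ ⟨k, hk8⟩ := by
        intro h; have := congrArg Fin.val h; simp at this; omega
      rw [updateCol_ne this]
      exact hR0 i (by omega) l

/-- Upper triangular coefficient matrix. -/
def upper (a : Matrix (Fin 8) (Fin 8) ℤ) : Matrix (Fin 8) (Fin 8) ℤ :=
  Matrix.of fun i j => if i ≤ j then a i j else 0

lemma Qform_eq (a : Matrix (Fin 8) (Fin 8) ℤ) (x : Fin 8 → ℤ) :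
    Qform a x = x ⬝ᵥ upper a *ᵥ x := by
  simp only [Qform, upper, mulVec, dotProduct, Finset.mul_sum, of_apply]
  refine Finset.sum_congr rfl fun i _ => Finset.sum_congr rfl fun j _ => ?_
  split_ifs <;> ring

lemma gram_eq (a : Matrix (Fin 8) (Fin 8) ℤ) : _root_.gram a = upper a + (upper a)ᵀ := by
  ext i j
  simp only [_root_.gram, Tbil, Qform_eq, of_apply, mulVec_add, add_dotProduct, dotProduct_add]
  simp
  ring

lemma gram_symm (a : Matrix (Fin 8) (Fin 8) ℤ) : (_root_.gram a)ᵀ = _root_.gram a := by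
  rw [gram_eq, transpose_add, transpose_transpose, add_comm]

lemma gram_quad (a : Matrix (Fin 8) (Fin 8) ℤ) (x : Fin 8 → ℤ) :
    x ⬝ᵥ _root_.gram a *ᵥ x = 2 * Qform a x := by
  rw [gram_eq, Qform_eq, add_mulVec, dotProduct_add, mulVec_transpose, dotProduct_comm x (x ᵥ* _),
    ← dotProduct_mulVec]
  ring

lemma rank_ge (G R : Matrix (Fin 8) (Fin 8) ℤ) (hdet : G.det = 1)
    (hRS : R * (Rᵀ * G) = (2 : ℤ) • 1) : 4 ≤ (Wmat G R).rank := by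
  have hle : LinearMap.ker (Wmat G R).mulVecLin ≤
      LinearMap.range (R.map (Int.cast : ℤ → ZMod 2)).mulVecLin := by
    intro w hw
    rw [LinearMap.mem_ker, mulVecLin_apply] at hw
    set x : Fin 8 → ℤ := fun j => ((w j).val : ℤ) with hx
    have hxw : (fun j => (x j : ZMod 2)) = w := by
      ext j; simp [hx]
    have hdiv : ∀ i, (2 : ℤ) ∣ ((Rᵀ * G) *ᵥ x) i := by
      intro i
      refine (ZMod.intCast_zmod_eq_zero_iff_dvd _ 2).1 ?_
      rw [← Wmat_mulVec, hxw, hw]; rfl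
    choose y hy using hdiv
    have hy' : (Rᵀ * G) *ᵥ x = (2 : ℤ) • y := by ext i; simp [hy i]
    have h1 : R *ᵥ ((Rᵀ * G) *ᵥ x) = (2 : ℤ) • x := by
      rw [mulVec_mulVec, hRS, smul_mulVec, one_mulVec]
    rw [hy', mulVec_smul] at h1
    have h2 : R *ᵥ y = x := smul_right_injective _ (by norm_num : (2 : ℤ) ≠ 0) h1
    refine ⟨fun j => (y j : ZMod 2), ?_⟩
    rw [mulVecLin_apply, ← hxw, ← h2]
    ext i
    simp [mulVec, dotProduct]
  have h1 := Submodule.finrank_mono hle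
  have h2 := LinearMap.finrank_range_add_finrank_ker (Wmat G R).mulVecLin
  have h3 := Wmat_rank G R hdet
  simp only [rank] at h3 ⊢
  simp at h2
  omega

lemma exists_rows (W : Matrix (Fin 8) (Fin 8) (ZMod 2)) (h : 4 ≤ W.rank) :
    ∃ e : Fin 4 → Fin 8, Function.Injective e ∧
      ∀ v : Fin 4 → ZMod 2, ∃ w, ∀ i, (W *ᵥ w) (e i) = v i := by
  obtain ⟨κ, f, hf, hspan, hli⟩ := exists_linearIndependent' (ZMod 2) W.row
  have : Finite κ := Finite.of_injective f hf
  have : Fintype κ := Fintype.ofFinite κ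
  have hc : 4 ≤ Fintype.card κ := by
    rw [← finrank_span_eq_card hli, hspan, ← rank_eq_finrank_span_row]; exact h
  obtain ⟨g⟩ : Nonempty (Fin 4 ↪ κ) := Function.Embedding.nonempty_of_card_le (by simpa using hc)
  refine ⟨f ∘ g, hf.comp g.injective, ?_⟩
  have hli' : LinearIndependent (ZMod 2) (W.submatrix (f ∘ g) id).row :=
    hli.comp g g.injective
  have hr := hli'.rank_matrix
  have ht : LinearMap.range (W.submatrix (f ∘ g) id).mulVecLin = ⊤ := by
    apply Submodule.eq_top_of_finrank_eq
    rw [rank] at hr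
    rw [hr]; simp
  intro v
  obtain ⟨w, hw⟩ := LinearMap.range_eq_top.1 ht v
  exact ⟨w, fun i => congrFun hw i⟩

lemma three_mod (u : Fin 4 → ZMod 2) (h : 4 ∣ 1 + ∑ i, (u i).val) :
    ∃ z, ∀ i, u i = if i = z then 0 else 1 := by
  revert u; decide

lemma z_inj (z z' : Fin 4)
    (h : 4 ∣ 2 + ∑ i : Fin 4, (((if i = z then 0 else 1) + (if i = z' then 0 else 1) : ZMod 2)).val) :
    z ≠ z' := by
  revert z z'; decide

lemma sum_delta (j : Fin 4) : ∑ i : Fin 4, ((if i = j then 1 else 0 : ZMod 2)).val = 1 := by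
  revert j; decide

lemma sum_delta2 (j k : Fin 4) (h : j ≠ k) :
    ∑ i : Fin 4, ((if i = j then 1 else 0 : ZMod 2) + (if i = k then 1 else 0 : ZMod 2)).val = 2 := by
  revert j k; decide

lemma exists_hamming (W : Matrix (Fin 8) (Fin 8) (ZMod 2)) (h : 4 ≤ W.rank)
    (hev : ∀ w, 4 ∣ ∑ i, ((W *ᵥ w) i).val) :
    ∃ (τ : Fin 4 ⊕ Fin 4 ≃ Fin 8) (c : Fin 4 → Fin 8 → ZMod 2), ∀ j i,
      (W *ᵥ c j) (τ (Sum.inl i)) = (if i = j then 1 else 0) ∧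
      (W *ᵥ c j) (τ (Sum.inr i)) = (if i = j then 0 else 1) := by
  obtain ⟨e, he, hw⟩ := exists_rows W h
  choose c hc using fun j : Fin 4 => hw (fun i => if i = j then 1 else 0)
  have hcard : Fintype.card ((Set.range e)ᶜ : Set (Fin 8)) = Fintype.card (Fin 4) := by
    rw [Fintype.card_compl_set, Set.card_range_of_injective he]; simp
  let τ : Fin 4 ⊕ Fin 4 ≃ Fin 8 :=
    ((Equiv.ofInjective e he).sumCongr (Fintype.equivOfCardEq hcard).symm).trans
      (Equiv.Set.sumCompl (Set.range e))
  have hτ (i : Fin 4) : τ (Sum.inl i) = e i := by simp [τ]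
  have hsum (w : Fin 8 → ZMod 2) : 4 ∣ ∑ i, ((W *ᵥ w) (τ (Sum.inl i))).val +
      ∑ i, ((W *ᵥ w) (τ (Sum.inr i))).val := by
    have := hev w
    rw [← Equiv.sum_comp τ, Fintype.sum_sum_type] at this
    exact this
  have h1 (j : Fin 4) : ∃ z, ∀ i, (W *ᵥ c j) (τ (Sum.inr i)) = if i = z then 0 else 1 := by
    apply three_mod
    have := hsum (c j)
    simp only [hτ, hc] at this
    rwa [sum_delta] at this
  choose z hz using h1
  have hzi : Function.Injective z := by
    intro j k hjk
    by_contra hne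
    have := hsum (c j + c k)
    simp only [hτ, mulVec_add, Pi.add_apply, hc, hz] at this
    rw [sum_delta2 j k hne] at this
    exact z_inj _ _ this hjk
  let ζ : Fin 4 ≃ Fin 4 := Equiv.ofBijective z (Finite.injective_iff_bijective.1 hzi)
  refine ⟨((Equiv.refl _).sumCongr ζ).trans τ, c, fun j i => ⟨?_, ?_⟩⟩
  · simp [hτ, hc]
  · have : ζ i = z i := rfl
    simp [this, hz, hzi.eq_iff]

/-- Gram matrix of `E8form`. -/
def Emat : Matrix (Fin 8) (Fin 8) ℤ :=
  !![2, 0, 1, 1, 1, 1, 1, 1;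
     0, 2, 0, 1, 1, 1, 1, 1;
     1, 0, 2, 1, 1, 1, 1, 1;
     1, 1, 1, 2, 1, 1, 1, 1;
     1, 1, 1, 1, 2, 1, 1, 1;
     1, 1, 1, 1, 1, 2, 1, 1;
     1, 1, 1, 1, 1, 1, 2, 1;
     1, 1, 1, 1, 1, 1, 1, 2]

/-- The inverse of `Emat`. -/
def Einv : Matrix (Fin 8) (Fin 8) ℤ :=
  !![4, 5, 3, -2, -2, -2, -2, -2;
     5, 8, 5, -3, -3, -3, -3, -3;
     3, 5, 4, -2, -2, -2, -2, -2;
     -2, -3, -2, 2, 1, 1, 1, 1;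
     -2, -3, -2, 1, 2, 1, 1, 1;
     -2, -3, -2, 1, 1, 2, 1, 1;
     -2, -3, -2, 1, 1, 1, 2, 1;
     -2, -3, -2, 1, 1, 1, 1, 2]

/-- First four coordinates of a basis of the Hamming code lattice. -/
def Btop : Matrix (Fin 4) (Fin 8) ℤ :=
  !![2, 0, 1, 1, 1, 1, 1, 1;
     0, 2, 0, 1, 1, 1, 1, 1;
     0, 0, 0, 0, 0, 0, 0, 1;
     0, 0, 0, 0, 0, 1, -1, 0]

/-- Last four coordinates of a basis of the Hamming code lattice. -/
def Bbot : Matrix (Fin 4) (Fin 8) ℤ :=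
  !![0, 0, 0, 1, -1, 0, 0, 0;
     0, 0, 1, 1, 1, 0, 0, 0;
     0, 0, 1, 0, 0, 1, 1, 0;
     0, 0, 1, 0, 0, 0, 0, 1]

lemma Einv_mul : Einv * Emat = 1 := by
  ext i j
  have h : ∀ i j : Fin 8, ∑ k, Einv i k * Emat k j = if i = j then 1 else 0 := by decide
  rw [mul_apply, one_apply, h]

lemma B_gram (p q : Fin 8) :
    ∑ i, Btop i p * Btop i q + ∑ i, Bbot i p * Bbot i q = 2 * Emat p q := by
  revert p q; decide

lemma Bbot_mod (i : Fin 4) (j : Fin 8) :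
    ((Bbot i j : ℤ) : ZMod 2) = ∑ k, ((Btop k j : ℤ) : ZMod 2) * (if i = k then 0 else 1) := by
  revert i j; decide

lemma Emat_quad (x : Fin 8 → ℤ) : x ⬝ᵥ Emat *ᵥ x = 2 * E8form x := by
  simp [Emat, E8form, dotProduct, mulVec, Fin.sum_univ_eight]
  ring

lemma sq_mod (n : ℤ) : (4 : ℤ) ∣ n ^ 2 - ((n : ZMod 2).val : ℤ) := by
  rcases Int.even_or_odd' n with ⟨m, rfl | rfl⟩
  · have : (((2 * m : ℤ)) : ZMod 2) = 0 := by
      push_cast; rw [show (2 : ZMod 2) = 0 from rfl, zero_mul]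
    rw [this]; exact ⟨m ^ 2, by simp; ring⟩
  · have : (((2 * m + 1 : ℤ)) : ZMod 2) = 1 := by
      push_cast; rw [show (2 : ZMod 2) = 0 from rfl, zero_mul, zero_add]
    rw [this]; exact ⟨m ^ 2 + m, by rw [ZMod.val_one]; push_cast; ring⟩

lemma exists_M (G : Matrix (Fin 8) (Fin 8) ℤ) (hsym : Gᵀ = G) (hdet : G.det = 1)
    (hpos : ∀ x : Fin 8 → ℤ, x ≠ 0 → 0 < x ⬝ᵥ G *ᵥ x)
    (heven : ∀ x : Fin 8 → ℤ, (2 : ℤ) ∣ x ⬝ᵥ G *ᵥ x) :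
    ∃ M : Matrix (Fin 8) (Fin 8) ℤ, Mᵀ * G * M = Emat := by
  obtain ⟨R, hR, -⟩ := exists_frame G hsym hdet hpos heven 8 le_rfl
  have hSR : (Rᵀ * G) * R = (2 : ℤ) • (1 : Matrix (Fin 8) (Fin 8) ℤ) := by
    rw [hR]; ext i j; simp [diagonal_apply, one_apply]
  have hRS : R * (Rᵀ * G) = (2 : ℤ) • (1 : Matrix (Fin 8) (Fin 8) ℤ) := by
    have hd : R.det ≠ 0 := by
      intro h
      have := congrArg det hSR
      rw [det_mul, h, det_smul] at this
      simp at this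
    have h1 : R * ((Rᵀ * G) * R) = (2 : ℤ) • R := by rw [hSR, Matrix.mul_smul, Matrix.mul_one]
    have h2 : (R * (Rᵀ * G) - (2 : ℤ) • (1 : Matrix (Fin 8) (Fin 8) ℤ)) * R = 0 := by
      rw [Matrix.sub_mul, Matrix.mul_assoc, h1, Matrix.smul_mul, Matrix.one_mul, sub_self]
    have h3 := congrArg (· * R.adjugate) h2
    simp only [Matrix.mul_assoc, mul_adjugate, Matrix.zero_mul, Matrix.mul_smul, Matrix.mul_one] at h3
    have h4 := (smul_eq_zero.1 h3).resolve_left hd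
    rw [← Matrix.mul_assoc] at h4 ⊢
    exact sub_eq_zero.1 (by simpa [Matrix.mul_assoc] using h4)
  have hSS : (Rᵀ * G)ᵀ * (Rᵀ * G) = (2 : ℤ) • G := by
    rw [transpose_mul, transpose_transpose, hsym, Matrix.mul_assoc, hRS, Matrix.mul_smul,
      Matrix.mul_one]
  have hquad (x : Fin 8 → ℤ) :
      ∑ i, (((Rᵀ * G) *ᵥ x) i) ^ 2 = 2 * (x ⬝ᵥ G *ᵥ x) := by
    have h : ((Rᵀ * G) *ᵥ x) ⬝ᵥ ((Rᵀ * G) *ᵥ x) = 2 * (x ⬝ᵥ G *ᵥ x) := by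
      rw [dotProduct_mulVec, ← mulVec_transpose, mulVec_mulVec, hSS, dotProduct_comm, smul_mulVec,
        dotProduct_smul, smul_eq_mul]
    rw [← h]
    simp [dotProduct, pow_two]
  have hev : ∀ w, 4 ∣ ∑ i, ((Wmat G R *ᵥ w) i).val := by
    intro w
    set x : Fin 8 → ℤ := fun j => ((w j).val : ℤ) with hx
    have hxw : (fun j => (x j : ZMod 2)) = w := by
      ext j; simp [hx]
    rw [← hxw]
    simp only [Wmat_mulVec]
    have h1 : (4 : ℤ) ∣ ∑ i, (((Rᵀ * G) *ᵥ x) i) ^ 2 := by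
      rw [hquad]; have := heven x; omega
    have h2 : (4 : ℤ) ∣ ∑ i, ((((Rᵀ * G) *ᵥ x) i) ^ 2 -
        (((((Rᵀ * G) *ᵥ x) i : ℤ) : ZMod 2).val : ℤ)) :=
      Finset.dvd_sum fun i _ => sq_mod _
    rw [Finset.sum_sub_distrib] at h2
    have h3 := (dvd_sub_right h1).1 h2
    exact_mod_cast h3
  obtain ⟨τ, c, hc⟩ := exists_hamming (Wmat G R) (rank_ge G R hdet hRS) hev
  have hcol (j : Fin 8) : ∃ y : Fin 8 → ℤ,
      (∀ i, ((Rᵀ * G) *ᵥ y) (τ (Sum.inl i)) = Btop i j) ∧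
      (∀ i, ((Rᵀ * G) *ᵥ y) (τ (Sum.inr i)) = Bbot i j) := by
    set b : Fin 8 → ℤ := fun i => Sum.elim (fun i => Btop i j) (fun i => Bbot i j) (τ.symm i) with hb
    set w : Fin 8 → ZMod 2 := ∑ k, ((Btop k j : ℤ) : ZMod 2) • c k with hw
    set x : Fin 8 → ℤ := fun j => ((w j).val : ℤ) with hx
    have hxw : (fun j => (x j : ZMod 2)) = w := by
      ext j; simp [hx]
    have hW (l : Fin 8) : (Wmat G R *ᵥ w) l =
        ∑ k, ((Btop k j : ℤ) : ZMod 2) * (Wmat G R *ᵥ c k) l := by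
      rw [hw, mulVec_sum]
      simp [mulVec_smul]
    have hdiv : ∀ i, (2 : ℤ) ∣ b i - ((Rᵀ * G) *ᵥ x) i := by
      intro i
      refine (ZMod.intCast_zmod_eq_zero_iff_dvd _ 2).1 ?_
      rw [Int.cast_sub, ← Wmat_mulVec, hxw, hW, sub_eq_zero]
      obtain ⟨i, rfl⟩ := τ.surjective i
      rcases i with i | i
      · simp [hb, (hc _ _).1]
      · simp only [hb, (hc _ _).2, Equiv.symm_apply_apply, Sum.elim_inr]
        exact Bbot_mod i j
    choose v hv using hdiv
    have hy : (Rᵀ * G) *ᵥ (x + R *ᵥ v) = b := by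
      rw [mulVec_add, mulVec_mulVec, hSR]
      ext i
      have := hv i
      simp only [Pi.add_apply, smul_mulVec, one_mulVec, Pi.smul_apply, smul_eq_mul]
      omega
    exact ⟨x + R *ᵥ v, fun i => by rw [hy]; simp [hb], fun i => by rw [hy]; simp [hb]⟩
  choose y hy1 hy2 using hcol
  refine ⟨Matrix.of fun i j => y j i, ?_⟩
  set M : Matrix (Fin 8) (Fin 8) ℤ := Matrix.of fun i j => y j i with hM
  have key : ((Rᵀ * G) * M)ᵀ * ((Rᵀ * G) * M) = (2 : ℤ) • Emat := by
    ext p q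
    rw [mul_apply, ← Equiv.sum_comp τ, Fintype.sum_sum_type]
    have e (l j : Fin 8) : ((Rᵀ * G) * M) l j = ((Rᵀ * G) *ᵥ y j) l := rfl
    simp only [transpose_apply, e, hy1, hy2]
    rw [B_gram]; rfl
  have key2 : (2 : ℤ) • (Mᵀ * G * M) = (2 : ℤ) • Emat := by
    have e : ((Rᵀ * G) * M)ᵀ * ((Rᵀ * G) * M) = Mᵀ * ((Rᵀ * G)ᵀ * (Rᵀ * G)) * M := by
      rw [transpose_mul (Rᵀ * G) M]; simp only [Matrix.mul_assoc]
    rw [← key, e, hSS, Matrix.mul_smul, Matrix.smul_mul]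
  exact smul_right_injective _ (by norm_num : (2 : ℤ) ≠ 0) key2

end MordellE8

/-- Mordell's theorem: every positive definite integral quadratic form
in `8` variables with discriminant `1` is `GL₈(ℤ)`-equivalent to `E₈`. -/
theorem mordell_E8 (a : Matrix (Fin 8) (Fin 8) ℤ) (hpos : PosDef a) (hdisc : HasDisc a 1) :
    FormEquiv (Qform a) E8form := by
  have hdet : (gram a).det = 1 := by
    have h : (gram a).det = 2 ^ (eps 8) * 1 := hdisc
    rw [h, show eps 8 = 0 from by simp [eps, show Even 8 from ⟨4, rfl⟩]]; rfl
  obtain ⟨M, hM⟩ := MordellE8.exists_M (gram a) (MordellE8.gram_symm a) hdet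
    (fun x hx => by rw [MordellE8.gram_quad]; have := hpos x hx; omega)
    (fun x => by rw [MordellE8.gram_quad]; exact Dvd.intro _ rfl)
  have h1 : (MordellE8.Einv * (M.transpose * gram a)) * M = 1 := by
    rw [Matrix.mul_assoc, hM, MordellE8.Einv_mul]
  have h2 : M * (MordellE8.Einv * (M.transpose * gram a)) = 1 := mul_eq_one_comm.1 h1
  refine ⟨⟨MordellE8.Einv * (M.transpose * gram a), M, h1, h2⟩, fun x => ?_⟩
  change E8form x = Qform a (M.mulVec x)
  have e1 := MordellE8.gram_quad a (M.mulVec x)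
  have e2 := MordellE8.Emat_quad x
  rw [← hM, Matrix.mul_assoc, ← Matrix.mulVec_mulVec, Matrix.dotProduct_mulVec,
    Matrix.vecMul_transpose, ← Matrix.mulVec_mulVec] at e2
  omega
end
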